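/- Let S = [[1,1],[1,0]] be the star matrix. For all natural numbers n, m and every real α, the following identity of vectors in ℂ^{2^{n+m}} holds: (I₂^{⊗n} ⊗ S^{⊗m}) (|0⟩^{⊗(n+m)} + e^{iα}|1⟩^{⊗(n+m)}) = √2^m · |0⟩^{⊗n} ⊗ |+⟩^{⊗m} + e^{iα} · |1⟩^{⊗n} ⊗ |0⟩^{⊗m}. In particular, the state of a Z-spider with phase α, n plain output legs and m star-edge output legs is a sum of exactly two stabilizer product states. -/

import Mathlib

open Matrix Complex
open scoped Kronecker

/-- The computational basis state `|0⟩` in `ℂ²`. -/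
noncomputable def ket0 : Fin 2 → ℂ := ![1, 0]

/-- The computational basis state `|1⟩` in `ℂ²`. -/
noncomputable def ket1 : Fin 2 → ℂ := ![0, 1]

/-- The state `|+⟩ = (|0⟩ + |1⟩)/√2`. -/
noncomputable def ketP : Fin 2 → ℂ := fun i => (ket0 i + ket1 i) / Real.sqrt 2

/-- The star matrix `S = [[1,1],[1,0]]`. -/
noncomputable def starMat : Matrix (Fin 2) (Fin 2) ℂ := !![1, 1; 1, 0]

/-- The `n`-fold Kronecker (tensor) power `v^{⊗n}` of a vector `v : ℂ²`,
indexed by bit strings of length `n`. -/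
noncomputable def vpow (v : Fin 2 → ℂ) (n : ℕ) : (Fin n → Fin 2) → ℂ :=
  fun x => ∏ k, v (x k)

/-- The `n`-fold Kronecker (tensor) power `M^{⊗n}` of a `2×2` matrix,
indexed by bit strings of length `n`. -/
noncomputable def kpow (M : Matrix (Fin 2) (Fin 2) ℂ) (n : ℕ) :
    Matrix (Fin n → Fin 2) (Fin n → Fin 2) ℂ :=
  Matrix.of fun i j => ∏ k, M (i k) (j k)

/-- Kronecker (tensor) product of two vectors. -/
noncomputable def tens {I J : Type*} (v : I → ℂ) (w : J → ℂ) : I × J → ℂ :=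
  fun p => v p.1 * w p.2

/-- Kronecker powers of matrices act on Kronecker powers of vectors factorwise. -/
theorem kpow_mulVec_vpow (M : Matrix (Fin 2) (Fin 2) ℂ) (v : Fin 2 → ℂ) (n : ℕ) :
    (kpow M n).mulVec (vpow v n) = vpow (M.mulVec v) n := by
  ext x
  simp only [kpow, vpow, Matrix.mulVec, dotProduct, Matrix.of_apply, ← Finset.prod_mul_distrib]
  exact (Fintype.prod_sum fun k j => M (x k) j * v j).symm

/-- Mixed-product property of the Kronecker product, for a matrix acting on a vector. -/
theorem kronecker_mulVec_tens {I J K L : Type*} [Fintype K] [Fintype L]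
    (A : Matrix I K ℂ) (B : Matrix J L ℂ) (v : K → ℂ) (w : L → ℂ) :
    (A ⊗ₖ B).mulVec (tens v w) = tens (A.mulVec v) (B.mulVec w) := by
  ext p
  simp only [tens, Matrix.mulVec, dotProduct, Matrix.kroneckerMap_apply,
    Fintype.sum_prod_type, Finset.sum_mul_sum, mul_mul_mul_comm]

theorem vpow_smul (c : ℂ) (v : Fin 2 → ℂ) (n : ℕ) : vpow (c • v) n = c ^ n • vpow v n := by
  ext x
  simp [vpow, Finset.prod_mul_distrib]

theorem tens_smul {I J : Type*} (c : ℂ) (v : I → ℂ) (w : J → ℂ) :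
    tens v (c • w) = c • tens v w := by
  ext p
  simp [tens, mul_left_comm]

theorem starMat_mulVec_ket0 : starMat.mulVec ket0 = (Real.sqrt 2 : ℂ) • ketP := by
  have h : (Real.sqrt 2 : ℂ) ≠ 0 := by simp
  ext i
  fin_cases i <;> simp [starMat, ket0, ket1, ketP, h]

theorem starMat_mulVec_ket1 : starMat.mulVec ket1 = ket0 := by
  ext i
  fin_cases i <;> simp [starMat, ket0, ket1]

/-- The state of a Z-spider with phase `α`, `n` plain output legs and `m` star-edge
output legs is a sum of exactly two stabilizer product states:
`(I₂^{⊗n} ⊗ S^{⊗m})(|0⟩^{⊗(n+m)} + e^{iα}|1⟩^{⊗(n+m)})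
  = √2^m · |0⟩^{⊗n} ⊗ |+⟩^{⊗m} + e^{iα} · |1⟩^{⊗n} ⊗ |0⟩^{⊗m}`. -/
theorem zSpider_star_legs_decomposition (n m : ℕ) (α : ℝ) :
    (kpow (1 : Matrix (Fin 2) (Fin 2) ℂ) n ⊗ₖ kpow starMat m).mulVec
        (tens (vpow ket0 n) (vpow ket0 m)
          + Complex.exp (α * Complex.I) • tens (vpow ket1 n) (vpow ket1 m))
    = ((Real.sqrt 2 : ℂ) ^ m) • tens (vpow ket0 n) (vpow ketP m)
      + Complex.exp (α * Complex.I) • tens (vpow ket1 n) (vpow ket0 m) := by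
  rw [Matrix.mulVec_add, Matrix.mulVec_smul, kronecker_mulVec_tens, kronecker_mulVec_tens]
  simp only [kpow_mulVec_vpow, Matrix.one_mulVec, starMat_mulVec_ket0, starMat_mulVec_ket1,
    vpow_smul, tens_smul]
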